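/- For an integer n with 1 ≤ n ≤ q−1, let O(n) ⊆ {1,…,q−1} denote the orbit of n under the map sending i to the unique representative in {1,…,q−1} of p·i modulo q−1. Then for every integer n ≥ 1: e^{(n)} > 0 if and only if n ≤ q−1 and n is the least element of O(n); and in that case e^{(n)} = deg f_{ω^n} = [F_p(ω^n) : F_p] = |O(n)|, which divides e. In particular, e^{(n)} = 0 whenever p divides n. -/

import Mathlib

open Polynomial

noncomputable section

variable (p : ℕ) [Fact p.Prime]

/-- `fN n` is the least common multiple of the minimal polynomials over `F_p` of
`ω, ω², …, ω^{n-1}`. -/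
def fN (F : Type) [Field F] [Algebra (ZMod p) F] (ω : Fˣ) (n : ℕ) : Polynomial (ZMod p) :=
  Finset.lcm (Finset.Ico 1 n) (fun i => minpoly (ZMod p) (((ω : F)) ^ i))

/-- `eN n = deg f^{(n+1)} − deg f^{(n)}`. -/
def eN (F : Type) [Field F] [Algebra (ZMod p) F] (ω : Fˣ) (n : ℕ) : ℕ :=
  (fN p F ω (n + 1)).natDegree - (fN p F ω n).natDegree

/-- The map on `{1,…,q−1}` sending `i` to the representative in `{1,…,q−1}` of
`p·i` modulo `q−1`. -/
def stepF (p q i : ℕ) : ℕ := if (p * i) % (q - 1) = 0 then q - 1 else (p * i) % (q - 1)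

lemma stepF_mem_Icc {r q : ℕ} (hq : 2 ≤ q) (i : ℕ) : stepF r q i ∈ Set.Icc 1 (q - 1) := by
  have hlt := Nat.mod_lt (r * i) (show q - 1 > 0 by omega)
  unfold stepF
  split_ifs <;> constructor <;> omega

lemma stepF_iterate_mem_Icc {r q n : ℕ} (hq : 2 ≤ q) (hn : n ∈ Set.Icc 1 (q - 1)) (k : ℕ) :
    (stepF r q)^[k] n ∈ Set.Icc 1 (q - 1) := by
  cases k with
  | zero => exact hn
  | succ k => rw [Function.iterate_succ_apply']; exact stepF_mem_Icc hq _

lemma pow_stepF {M : Type*} [Monoid M] {x : M} {r q : ℕ} (hx : x ^ (q - 1) = 1) (i : ℕ) :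
    x ^ stepF r q i = (x ^ i) ^ r := by
  rw [← pow_mul, mul_comm i r, pow_eq_pow_mod (r * i) hx]
  unfold stepF
  split_ifs with h
  · rw [h, hx, pow_zero]
  · rfl

lemma pow_stepF_iterate {M : Type*} [Monoid M] {x : M} {r q : ℕ} (hx : x ^ (q - 1) = 1)
    (n k : ℕ) : x ^ (stepF r q)^[k] n = (x ^ n) ^ r ^ k := by
  induction k with
  | zero => simp
  | succ k ih => rw [Function.iterate_succ_apply', pow_stepF hx, ih, ← pow_mul, ← pow_succ]

lemma pow_injOn_Icc_orderOf {G : Type*} [Group G] (x : G) :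
    Set.InjOn (fun i : ℕ => x ^ i) (Set.Icc 1 (orderOf x)) := by
  rintro i ⟨hi, hi'⟩ j ⟨hj, hj'⟩ h
  have h' : i ≡ j [MOD orderOf x] := pow_eq_pow_iff_modEq.mp h
  rcases le_total i j with hij | hij
  · by_contra hne
    have := Nat.le_of_dvd (by omega) ((Nat.modEq_iff_dvd' hij).mp h')
    omega
  · by_contra hne
    have := Nat.le_of_dvd (by omega) ((Nat.modEq_iff_dvd' hij).mp h'.symm)
    omega

lemma minpoly_eq_iff_exists_pow (F : Type*) [Field F] [Finite F] [Algebra (ZMod p) F] (x y : F) :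
    minpoly (ZMod p) x = minpoly (ZMod p) y ↔ ∃ k : ℕ, y = x ^ p ^ k := by
  have hfrob (k : ℕ) :
      (FiniteField.frobeniusAlgEquivOfAlgebraic (ZMod p) F ^ k) x = x ^ p ^ k := by
    rw [AlgEquiv.coe_pow, FiniteField.coe_frobeniusAlgEquivOfAlgebraic_iterate, ZMod.card]
  constructor
  · intro h
    obtain ⟨σ, hσ⟩ := isConjRoot_iff_exists_algEquiv.mp (show IsConjRoot (ZMod p) y x from h.symm)
    obtain ⟨k, rfl⟩ :=
      (FiniteField.bijective_frobeniusAlgEquivOfAlgebraic_pow (ZMod p) F).surjective σ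
    exact ⟨k, by rw [← hσ, hfrob]⟩
  · rintro ⟨k, rfl⟩
    rw [← hfrob, minpoly.algEquiv_eq]

lemma natDegree_lcm_of_isCoprime {K : Type*} [Field K] {f g : K[X]} [NormalizedGCDMonoid K[X]]
    (hf : f ≠ 0) (hg : g ≠ 0) (h : IsCoprime f g) :
    (lcm f g).natDegree = f.natDegree + g.natDegree := by
  rw [← natDegree_mul hf hg]
  refine natDegree_eq_of_degree_eq (degree_eq_degree_of_associated ?_)
  exact associated_of_dvd_dvd (lcm_dvd (dvd_mul_right _ _) (dvd_mul_left _ _))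
    (h.mul_dvd (dvd_lcm_left _ _) (dvd_lcm_right _ _))

section LCM

variable (F : Type) [Field F] [Algebra (ZMod p) F] (ω : Fˣ)

lemma fN_succ {n : ℕ} (hn : 1 ≤ n) :
    fN p F ω (n + 1) = lcm (minpoly (ZMod p) ((ω : F) ^ n)) (fN p F ω n) := by
  unfold fN
  rw [← Finset.insert_Ico_right_eq_Ico_add_one hn, Finset.lcm_insert]

lemma eN_eq_zero_of_minpoly_eq {m n : ℕ} (hm : 1 ≤ m) (hmn : m < n)
    (h : minpoly (ZMod p) ((ω : F) ^ m) = minpoly (ZMod p) ((ω : F) ^ n)) :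
    eN p F ω n = 0 := by
  have hdvd : minpoly (ZMod p) ((ω : F) ^ n) ∣ fN p F ω n := by
    rw [← h]
    exact Finset.dvd_lcm (f := fun i => minpoly (ZMod p) ((ω : F) ^ i))
      (Finset.mem_Ico.mpr ⟨hm, hmn⟩)
  have : (fN p F ω (n + 1)).natDegree = (fN p F ω n).natDegree := by
    rw [fN_succ p F ω (hm.trans hmn.le)]
    exact natDegree_eq_of_degree_eq (degree_eq_degree_of_associated
      (associated_of_dvd_dvd (lcm_dvd hdvd dvd_rfl) (dvd_lcm_right _ _)))
  rw [eN, this, Nat.sub_self]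

lemma eN_eq_natDegree_of_minpoly_ne [Finite F] {n : ℕ} (hn : 1 ≤ n)
    (h : ∀ i, 1 ≤ i → i < n →
      minpoly (ZMod p) ((ω : F) ^ i) ≠ minpoly (ZMod p) ((ω : F) ^ n)) :
    eN p F ω n = (minpoly (ZMod p) ((ω : F) ^ n)).natDegree := by
  have hint (x : F) : IsIntegral (ZMod p) x := Algebra.IsIntegral.isIntegral x
  have hprod : fN p F ω n ∣ ∏ i ∈ Finset.Ico 1 n, minpoly (ZMod p) ((ω : F) ^ i) :=
    Finset.lcm_dvd fun i hi =>
      Finset.dvd_prod_of_mem (fun i => minpoly (ZMod p) ((ω : F) ^ i)) hi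
  have hcop : IsCoprime (minpoly (ZMod p) ((ω : F) ^ n)) (fN p F ω n) := by
    refine IsCoprime.of_isCoprime_of_dvd_right (IsCoprime.prod_right fun i hi => ?_) hprod
    rw [Finset.mem_Ico] at hi
    refine ((minpoly.irreducible (hint _)).coprime_iff_not_dvd).mpr fun hd => h i hi.1 hi.2 ?_
    exact (eq_of_monic_of_associated (minpoly.monic (hint _)) (minpoly.monic (hint _))
      ((minpoly.irreducible (hint _)).associated_of_dvd (minpoly.irreducible (hint _)) hd)).symm
  have hne : fN p F ω n ≠ 0 :=
    ne_zero_of_dvd_ne_zero (Finset.prod_ne_zero_iff.mpr fun i _ => minpoly.ne_zero (hint _)) hprod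
  rw [eN, fN_succ p F ω hn, natDegree_lcm_of_isCoprime (minpoly.ne_zero (hint _)) hne hcop,
    Nat.add_sub_cancel]

end LCM

lemma natDegree_minpoly_eq_ncard_powers (F : Type*) [Field F] [Finite F] [Algebra (ZMod p) F]
    (x : F) : (minpoly (ZMod p) x).natDegree = {y : F | ∃ k : ℕ, y = x ^ p ^ k}.ncard := by
  have hint : IsIntegral (ZMod p) x := Algebra.IsIntegral.isIntegral x
  rw [← card_rootSet_eq_natDegree (K := F) (Algebra.IsSeparable.isSeparable (ZMod p) x)
    (Normal.splits inferInstance x), ← Nat.card_eq_fintype_card, Nat.card_coe_set_eq]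
  congr 1
  ext y
  rw [← isConjRoot_iff_mem_minpoly_rootSet hint]
  exact minpoly_eq_iff_exists_pow p F x y

/-- For `1 ≤ n ≤ q−1` let `O(n)` be the orbit of `n` under `i ↦ p·i mod (q−1)`
(representatives in `{1,…,q−1}`).  Then for every `n ≥ 1`: `e^{(n)} > 0` iff
`n ≤ q−1` and `n` is the least element of `O(n)`; in that case
`e^{(n)} = deg f_{ω^n} = [F_p(ω^n) : F_p] = |O(n)|`, which divides `e`.
In particular `e^{(n)} = 0` whenever `p ∣ n`. -/
theorem stmt_9 (e : ℕ) (he : 1 ≤ e) (F : Type) [Field F] [Fintype F]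
    [Algebra (ZMod p) F] (hF : Fintype.card F = p ^ e)
    (ω : Fˣ) (hω : ∀ x : Fˣ, x ∈ Subgroup.zpowers ω)
    (n : ℕ) (hn : 1 ≤ n) :
    (0 < eN p F ω n ↔ (n ≤ p ^ e - 1 ∧ ∀ k : ℕ, n ≤ (stepF p (p ^ e))^[k] n)) ∧
    ((n ≤ p ^ e - 1 ∧ ∀ k : ℕ, n ≤ (stepF p (p ^ e))^[k] n) →
      eN p F ω n = (minpoly (ZMod p) ((ω : F) ^ n)).natDegree ∧
      eN p F ω n =
        Module.finrank (ZMod p) (↥(IntermediateField.adjoin (ZMod p) {((ω : F) ^ n)})) ∧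
      eN p F ω n = Set.ncard {m : ℕ | ∃ k : ℕ, (stepF p (p ^ e))^[k] n = m} ∧
      eN p F ω n ∣ e) ∧
    (p ∣ n → eN p F ω n = 0) := by
  have hcard : Nat.card F = p ^ e := by rw [Nat.card_eq_fintype_card, hF]
  have hq : 2 ≤ p ^ e :=
    (Fact.out : p.Prime).two_le.trans (Nat.le_self_pow (by omega) p)
  have hord : orderOf ω = p ^ e - 1 := by
    rw [orderOf_eq_card_of_forall_mem_zpowers hω, Nat.card_units, hcard]
  have hωq : (ω : F) ^ (p ^ e - 1) = 1 := by
    rw [← hord, ← Units.val_pow_eq_pow_val, pow_orderOf_eq_one, Units.val_one]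
  have hinj : Set.InjOn (fun i : ℕ => (ω : F) ^ i) (Set.Icc 1 (p ^ e - 1)) := by
    intro i hi j hj h
    rw [← hord] at hi hj
    exact pow_injOn_Icc_orderOf ω hi hj (Units.ext (by simpa using h))
  have hdeg (h : n ≤ p ^ e - 1 ∧ ∀ k : ℕ, n ≤ (stepF p (p ^ e))^[k] n) :
      eN p F ω n = (minpoly (ZMod p) ((ω : F) ^ n)).natDegree := by
    refine eN_eq_natDegree_of_minpoly_ne p F ω hn fun i hi hin heq => ?_
    obtain ⟨k, hk⟩ := (minpoly_eq_iff_exists_pow p F _ _).mp heq.symm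
    rw [← pow_stepF_iterate hωq] at hk
    have := hinj ⟨hi, hin.le.trans h.1⟩ (stepF_iterate_mem_Icc hq ⟨hn, h.1⟩ k) hk
    have := h.2 k
    omega
  have hint : IsIntegral (ZMod p) ((ω : F) ^ n) := Algebra.IsIntegral.isIntegral _
  refine ⟨⟨fun hpos => ?_, fun h => ?_⟩, fun h => ?_, ?_⟩
  · have hle : n ≤ p ^ e - 1 := by
      by_contra! hlt
      refine hpos.ne' (eN_eq_zero_of_minpoly_eq p F ω (m := n - (p ^ e - 1)) (by omega)
        (by omega) ?_)
      conv_rhs => rw [← Nat.sub_add_cancel hlt.le, pow_add, hωq, mul_one]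
    refine ⟨hle, fun k => ?_⟩
    by_contra! hlt
    refine hpos.ne' (eN_eq_zero_of_minpoly_eq p F ω
      (stepF_iterate_mem_Icc hq ⟨hn, hle⟩ k).1 hlt ?_)
    exact ((minpoly_eq_iff_exists_pow p F _ _).mpr ⟨k, pow_stepF_iterate hωq n k⟩).symm
  · rw [hdeg h]
    exact minpoly.natDegree_pos hint
  · rw [hdeg h]
    refine ⟨rfl, (IntermediateField.adjoin.finrank hint).symm, ?_, ?_⟩
    · rw [natDegree_minpoly_eq_ncard_powers]
      have himage : {y : F | ∃ k : ℕ, y = ((ω : F) ^ n) ^ p ^ k} =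
          (fun i : ℕ => (ω : F) ^ i) '' {m : ℕ | ∃ k : ℕ, (stepF p (p ^ e))^[k] n = m} := by
        ext y
        simp [← pow_stepF_iterate hωq, eq_comm]
      rw [himage, Set.InjOn.ncard_image]
      refine hinj.mono ?_
      rintro _ ⟨k, rfl⟩
      exact stepF_iterate_mem_Icc hq ⟨hn, h.1⟩ k
    · have hfin : Module.finrank (ZMod p) F = e := by
        have := Module.natCard_eq_pow_finrank (K := ZMod p) (V := F)
        rw [hcard, Nat.card_zmod] at this
        exact (Nat.pow_right_injective (Fact.out : p.Prime).two_le this).symm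
      rw [← IntermediateField.adjoin.finrank hint, ← hfin]
      exact ⟨_, (Module.finrank_mul_finrank (ZMod p)
        (IntermediateField.adjoin (ZMod p) {(ω : F) ^ n}) F).symm⟩
  · rintro ⟨m, rfl⟩
    have hm : 1 ≤ m := Nat.pos_of_mul_pos_left hn
    refine eN_eq_zero_of_minpoly_eq p F ω hm
      (lt_mul_of_one_lt_left hm (Fact.out : p.Prime).one_lt) ?_
    exact (minpoly_eq_iff_exists_pow p F _ _).mpr ⟨1, by rw [pow_one, ← pow_mul, mul_comm]⟩

end
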